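/- Let L₀ be a countable language and μ an invariant measure on Str_{L₀}(ℕ). Then there exist a countable relational language L₁ and a non-redundant invariant measure ν on Str_{L₁}(ℕ) such that Ent(μ) = Ent(ν). Moreover, if L₀ is finite with maximum arity k, then L₁ can be taken to be finite with maximum arity k. -/

import Mathlib

open FirstOrder MeasureTheory
open scoped ENNReal

namespace PaperEntropy

/-- The logic action of a permutation of `ℕ` on the space of `L`-structures with
underlying set `ℕ`. -/
noncomputable def logicAction (L : FirstOrder.Language) (σ : Equiv.Perm ℕ)
    (S : L.Structure ℕ) : L.Structure ℕ where
  funMap := fun {m} f v => σ (@FirstOrder.Language.Structure.funMap L ℕ S m f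
    (fun i => σ.symm (v i)))
  RelMap := fun {m} r v => @FirstOrder.Language.Structure.RelMap L ℕ S m r
    (fun i => σ.symm (v i))

/-- Generating sets for the σ-algebra on the space of `L`-structures on `M`:
satisfaction sets of quantifier-free formulas at tuples of parameters. -/
def qfSets (L : FirstOrder.Language) (M : Type*) : Set (Set (L.Structure M)) :=
  { A | ∃ (m : ℕ) (φ : L.Formula (Fin m)), φ.IsQF ∧ ∃ v : Fin m → M,
      A = { S : L.Structure M | @FirstOrder.Language.Formula.Realize L M S (Fin m) φ v } }

noncomputable instance strMeasurableSpace (L : FirstOrder.Language) (M : Type*) :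
    MeasurableSpace (L.Structure M) :=
  MeasurableSpace.generateFrom (qfSets L M)

/-- `μ` is an invariant (probability) measure on `Str_L(ℕ)`. -/
def IsInvariantMeasure (L : FirstOrder.Language) (μ : Measure (L.Structure ℕ)) : Prop :=
  IsProbabilityMeasure μ ∧ ∀ σ : Equiv.Perm ℕ, Measure.map (logicAction L σ) μ = μ

/-- The set of non-redundant `L`-structures on `M`: relations hold only of tuples of
pairwise distinct elements. -/
def NonRedundant (L : FirstOrder.Language) (M : Type*) : Set (L.Structure M) :=
  { S | ∀ (m : ℕ) (r : L.Relations m) (v : Fin m → M),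
      @FirstOrder.Language.Structure.RelMap L M S m r v → Function.Injective v }

/-- The data of the restriction of an `L`-structure on `ℕ` to `[n] = {0, …, n-1}`:
the relational part, and the functional part recorded as `none` on tuples whose image
under the function escapes `[n]`. -/
structure FinRestriction (L : FirstOrder.Language) (n : ℕ) where
  rel : ∀ m, L.Relations m → (Fin m → Fin n) → Prop
  fn : ∀ m, L.Functions m → (Fin m → Fin n) → Option (Fin n)

instance finRestrictionMeasurableSpace (L : FirstOrder.Language) (n : ℕ) :
    MeasurableSpace (FinRestriction L n) :=
  MeasurableSpace.generateFrom
    ({ A | ∃ m r v, A = {x : FinRestriction L n | x.rel m r v} } ∪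
     { A | ∃ m f v o, A = {x : FinRestriction L n | x.fn m f v = o} })

/-- The restriction of an `L`-structure on `ℕ` to `[n]`. -/
noncomputable def restrict (L : FirstOrder.Language) (n : ℕ) (S : L.Structure ℕ) :
    FinRestriction L n where
  rel m r v := @FirstOrder.Language.Structure.RelMap L ℕ S m r (fun i => (v i : ℕ))
  fn m f v :=
    if h : (@FirstOrder.Language.Structure.funMap L ℕ S m f (fun i => (v i : ℕ))) < n
    then some ⟨_, h⟩ else none

/-- The entropy of a measure: `∞` if it is not purely atomic, and otherwise
`-∑ ν {x} log₂ ν {x}` over its atoms. -/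
noncomputable def entropy {α : Type*} [MeasurableSpace α] (ν : Measure α) : ℝ≥0∞ :=
  if ∑' a : α, ν {a} = ν Set.univ then
    ∑' a : α, ENNReal.ofReal (-((ν {a}).toReal * Real.logb 2 (ν {a}).toReal))
  else ⊤

/-- The entropy function of a measure on `Str_L(ℕ)`: the entropy of the measure induced
by restriction to `[n]`. -/
noncomputable def entFn (L : FirstOrder.Language) (μ : Measure (L.Structure ℕ)) (n : ℕ) :
    ℝ≥0∞ :=
  entropy (Measure.map (restrict L n) μ)

end PaperEntropy

open PaperEntropy MeasureTheory
open scoped ENNReal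

namespace PaperEntropy

open FirstOrder.Language FirstOrder.Language.Structure

universe u v w

variable {L : FirstOrder.Language.{u, v}}

theorem measurableSet_relMap {M : Type w} {m : ℕ} (r : L.Relations m) (x : Fin m → M) :
    MeasurableSet {S : L.Structure M | @RelMap L M S m r x} := by
  refine MeasurableSpace.measurableSet_generateFrom
    ⟨m, r.formula fun i => Term.var i, (BoundedFormula.IsAtomic.rel _ _).isQF, x, ?_⟩
  ext S
  simp [Formula.realize_rel]

theorem measurableSet_funMap_eq {M : Type w} {m : ℕ} (f : L.Functions m) (x : Fin m → M)
    (y : M) : MeasurableSet {S : L.Structure M | @funMap L M S m f x = y} := by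
  refine MeasurableSpace.measurableSet_generateFrom
    ⟨m + 1, (Term.func f fun i => Term.var i.castSucc).equal (Term.var (Fin.last m)),
      (BoundedFormula.IsAtomic.equal _ _).isQF, Fin.snoc x y, ?_⟩
  ext S
  simp [Formula.realize_equal]

/-- A map into structures for a relational language is measurable as soon as the events that a
given relation holds at a given tuple are measurable. -/
theorem measurable_of_measurableSet_relMap [L.IsRelational] {M : Type w} {α : Type*}
    [MeasurableSpace α] {F : α → L.Structure M}
    (h : ∀ (m : ℕ) (r : L.Relations m) (x : Fin m → M),
      MeasurableSet {a | @RelMap L M (F a) m r x}) : Measurable F := by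
  have term_eq_var : ∀ {β : Type} (t : L.Term β), ∃ b, t = Term.var b := by
    rintro β (b | ⟨f, _⟩)
    · exact ⟨b, rfl⟩
    · exact isEmptyElim f
  refine measurable_generateFrom ?_
  rintro _ ⟨m, φ, hφ, x, rfl⟩
  change MeasurableSet {a | @BoundedFormula.Realize L M (F a) (Fin m) 0 φ x default}
  induction hφ with
  | falsum => exact MeasurableSet.const False
  | of_isAtomic hφ =>
    cases hφ with
    | equal t₁ t₂ =>
      obtain ⟨b₁, rfl⟩ := term_eq_var t₁
      obtain ⟨b₂, rfl⟩ := term_eq_var t₂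
      exact MeasurableSet.const (Sum.elim x default b₁ = Sum.elim x default b₂)
    | rel R ts =>
      choose b hb using fun i => term_eq_var (ts i)
      obtain rfl : ts = fun i => Term.var (b i) := funext hb
      exact h _ R fun i => Sum.elim x default (b i)
  | imp _ _ ih₁ ih₂ => exact ih₁.imp ih₂

theorem measurable_logicAction [L.IsRelational] (σ : Equiv.Perm ℕ) :
    Measurable (logicAction L σ) :=
  measurable_of_measurableSet_relMap fun _ r x => measurableSet_relMap r fun i => σ.symm (x i)

theorem measurableSet_rel {n m : ℕ} (r : L.Relations m) (x : Fin m → Fin n) :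
    MeasurableSet {a : FinRestriction L n | a.rel m r x} :=
  MeasurableSpace.measurableSet_generateFrom (Or.inl ⟨m, r, x, rfl⟩)

theorem measurableSet_fn_eq {n m : ℕ} (f : L.Functions m) (x : Fin m → Fin n)
    (o : Option (Fin n)) : MeasurableSet {a : FinRestriction L n | a.fn m f x = o} :=
  MeasurableSpace.measurableSet_generateFrom (Or.inr ⟨m, f, x, o, rfl⟩)

theorem restrict_fn_eq_some_iff {n m : ℕ} (S : L.Structure ℕ) (f : L.Functions m)
    (x : Fin m → Fin n) (y : Fin n) :
    (restrict L n S).fn m f x = some y ↔ @funMap L ℕ S m f (fun i => (x i : ℕ)) = y := by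
  simp only [restrict]
  split_ifs with h
  · simp [Fin.ext_iff]
  · simp only [false_iff]
    exact fun h' => h (h' ▸ y.isLt)

theorem measurable_restrict (n : ℕ) : Measurable (restrict L n) := by
  have hsome : ∀ m (f : L.Functions m) (x : Fin m → Fin n) (y : Fin n),
      MeasurableSet {S : L.Structure ℕ | (restrict L n S).fn m f x = some y} := by
    intro m f x y
    simp only [restrict_fn_eq_some_iff]
    exact measurableSet_funMap_eq f _ _
  refine measurable_generateFrom ?_
  rintro _ (⟨m, r, x, rfl⟩ | ⟨m, f, x, o, rfl⟩)
  · exact measurableSet_relMap r fun i => (x i : ℕ)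
  · cases o with
    | some y => exact hsome m f x y
    | none =>
      change MeasurableSet {S : L.Structure ℕ | (restrict L n S).fn m f x = none}
      simp only [Option.eq_none_iff_forall_ne_some, Set.ofPred_forall]
      exact MeasurableSet.iInter fun y => (hsome m f x y).compl

theorem FinRestriction.eq_iff {n : ℕ} {a b : FinRestriction L n} :
    b = a ↔ (∀ m r x, b.rel m r x ↔ a.rel m r x) ∧ ∀ m f x, b.fn m f x = a.fn m f x := by
  constructor
  · rintro rfl
    simp
  · rcases a with ⟨ra, fa⟩
    rcases b with ⟨rb, fb⟩
    rintro ⟨hr, hf⟩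
    congr
    · ext m r x
      exact hr m r x
    · funext m f x
      exact hf m f x

theorem FinRestriction.measurableSingletonClass [∀ m, Countable (L.Functions m)]
    [∀ m, Countable (L.Relations m)] (n : ℕ) :
    MeasurableSingletonClass (FinRestriction L n) := by
  refine ⟨fun a => ?_⟩
  have : ({a} : Set (FinRestriction L n)) =
      {b | (∀ m r x, b.rel m r x ↔ a.rel m r x) ∧ ∀ m f x, b.fn m f x = a.fn m f x} := by
    ext b
    exact FinRestriction.eq_iff
  rw [this]
  simp only [Set.ofPred_and, Set.ofPred_forall]
  refine MeasurableSet.inter ?_ ?_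
  · exact MeasurableSet.iInter fun m => MeasurableSet.iInter fun r => MeasurableSet.iInter
      fun x => (measurableSet_rel r x).iff (MeasurableSet.const _)
  · exact MeasurableSet.iInter fun m => MeasurableSet.iInter fun f => MeasurableSet.iInter
      fun x => measurableSet_fn_eq f x _

/-- Entropy is preserved by measurable maps that are injective on a conull set. -/
theorem entropy_map_of_injOn {α β : Type*} [MeasurableSpace α] [MeasurableSpace β]
    [MeasurableSingletonClass β] {ρ : Measure α} {e : α → β} (he : Measurable e) {G : Set α}
    (hG : ρ Gᶜ = 0) (hinj : Set.InjOn e G) : entropy (Measure.map e ρ) = entropy ρ := by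
  have mem_G : ∀ a, ρ {a} ≠ 0 → a ∈ G := fun a ha => by
    by_contra h
    exact ha (measure_mono_null (Set.singleton_subset_iff.2 h) hG)
  have map_singleton : ∀ a ∈ G, Measure.map e ρ {e a} = ρ {a} := by
    intro a ha
    rw [Measure.map_apply he (measurableSet_singleton _)]
    refine le_antisymm ?_ (measure_mono (by simp))
    calc ρ (e ⁻¹' {e a}) ≤ ρ ({a} ∪ Gᶜ) := by
          refine measure_mono fun b hb => ?_
          by_cases h : b ∈ G
          · exact Or.inl (hinj h ha hb)
          · exact Or.inr h
      _ ≤ ρ {a} + ρ Gᶜ := measure_union_le _ _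
      _ = ρ {a} := by rw [hG, add_zero]
  have tsum_eq : ∀ F : ℝ≥0∞ → ℝ≥0∞, F 0 = 0 →
      ∑' b, F (Measure.map e ρ {b}) = ∑' a, F (ρ {a}) := by
    intro F hF
    have hsupp : ∀ a : Function.support fun a => F (ρ {a}), (a : α) ∈ G := fun a =>
      mem_G a fun h => a.2 (by simp [h, hF])
    refine tsum_eq_tsum_of_ne_zero_bij (fun a => e a) ?_ ?_ ?_
    · exact fun a b hab => Subtype.ext (hinj (hsupp a) (hsupp b) hab)
    · intro b hb
      have hb' : Measure.map e ρ {b} ≠ 0 := fun h => hb (by simp [h, hF])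
      rw [Measure.map_apply he (measurableSet_singleton _)] at hb'
      obtain ⟨a, hab, ha⟩ : (e ⁻¹' {b} ∩ G).Nonempty := by
        by_contra h
        refine hb' (measure_mono_null (fun a ha haG => h ⟨a, ha, haG⟩) hG)
      obtain rfl : e a = b := hab
      refine ⟨⟨a, ?_⟩, rfl⟩
      simpa [map_singleton a ha] using hb
    · intro a
      rw [map_singleton _ (hsupp a)]
  have huniv : Measure.map e ρ Set.univ = ρ Set.univ := by
    rw [Measure.map_apply he MeasurableSet.univ, Set.preimage_univ]
  unfold entropy
  rw [tsum_eq (fun t => t) rfl, huniv,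
    tsum_eq (fun t => ENNReal.ofReal (-(t.toReal * Real.logb 2 t.toReal))) (by simp)]

/-- Under an invariant measure, functions almost surely take values among their arguments. -/
theorem IsInvariantMeasure.measure_funMap_notMem_range {μ : Measure (L.Structure ℕ)}
    (hμ : IsInvariantMeasure L μ) {m : ℕ} (f : L.Functions m) (x : Fin m → ℕ) :
    μ {S | @funMap L ℕ S m f x ∉ Set.range x} = 0 := by
  obtain ⟨hprob, hinv⟩ := hμ
  set A : ℕ → Set (L.Structure ℕ) := fun y => {S | @funMap L ℕ S m f x = y} with hA
  have hmeas : ∀ y, MeasurableSet (A y) := measurableSet_funMap_eq f x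
  have hswap : ∀ y ∉ Set.range x, ∀ z ∉ Set.range x, μ (A z) = μ (A y) := by
    intro y hy z hz
    have hae : AEMeasurable (logicAction L (Equiv.swap y z)) μ :=
      aemeasurable_of_map_neZero (by rw [hinv]; infer_instance)
    have hfix : ∀ i, Equiv.swap y z (x i) = x i := fun i =>
      Equiv.swap_apply_of_ne_of_ne (fun h => hy ⟨i, h⟩) (fun h => hz ⟨i, h⟩)
    have hpre : logicAction L (Equiv.swap y z) ⁻¹' A z = A y := by
      ext S
      change Equiv.swap y z (@funMap L ℕ S m f fun i => Equiv.swap y z (x i)) = z ↔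
        @funMap L ℕ S m f x = y
      simp only [hfix, Equiv.swap_apply_eq_iff, Equiv.swap_apply_right]
    calc μ (A z) = Measure.map (logicAction L (Equiv.swap y z)) μ (A z) := by rw [hinv]
      _ = μ (A y) := by rw [Measure.map_apply_of_aemeasurable hae (hmeas z), hpre]
  have hzero : ∀ y ∉ Set.range x, μ (A y) = 0 := by
    intro y hy
    by_contra h
    have hfin := Measure.finite_const_le_meas_of_disjoint_iUnion μ (pos_iff_ne_zero.2 h)
      (As := A) hmeas ?_ (measure_ne_top μ _)
    · refine (Set.finite_range x).infinite_compl (hfin.subset fun z hz => ?_)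
      exact (hswap y hy z hz).ge
    · intro y z hyz
      exact Set.disjoint_left.2 fun S hy hz => hyz (hy.symm.trans hz)
  refine measure_mono_null (t := ⋃ y : ((Set.range x)ᶜ : Set ℕ), A y) ?_
    (measure_iUnion_null fun y => hzero y y.2)
  intro S hS
  exact Set.mem_iUnion.2 ⟨⟨_, hS⟩, rfl⟩

variable (L) in
/-- The `j`-ary symbols of the encoding language: a relation symbol, or a function symbol together
with the position of its value among its arguments, with arguments identified according to
`Fin m → Fin j`. -/
abbrev EncodedSymbol (j : ℕ) : Type (max u v) :=
  Σ m : {m : ℕ // j ≤ m}, (L.Relations m ⊕ (L.Functions m × Fin m)) × (Fin m → Fin j)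

/-- The interpretation of an encoded symbol in a structure. -/
def EncodedSymbol.Holds {M : Type w} (S : L.Structure M) {j : ℕ} (x : Fin j → M) :
    EncodedSymbol L j → Prop
  | ⟨m, .inl R, p⟩ => @RelMap L M S m R fun i => x (p i)
  | ⟨m, .inr (f, i), p⟩ => @funMap L M S m f (fun i => x (p i)) = x (p i)

/-- The interpretation of an encoded symbol in a restricted structure. -/
def EncodedSymbol.HoldsFin {n : ℕ} (a : FinRestriction L n) {j : ℕ} (x : Fin j → Fin n) :
    EncodedSymbol L j → Prop
  | ⟨m, .inl R, p⟩ => a.rel m R fun i => x (p i)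
  | ⟨m, .inr (f, i), p⟩ => a.fn m f (fun i => x (p i)) = some (x (p i))

theorem EncodedSymbol.holds_logicAction (σ : Equiv.Perm ℕ) (S : L.Structure ℕ) {j : ℕ}
    (x : Fin j → ℕ) (s : EncodedSymbol L j) :
    s.Holds (logicAction L σ S) x ↔ s.Holds S (fun i => σ.symm (x i)) := by
  rcases s with ⟨m, R | ⟨f, i⟩, p⟩
  · rfl
  · exact (Equiv.eq_symm_apply σ).symm

theorem EncodedSymbol.holdsFin_restrict {n : ℕ} (S : L.Structure ℕ) {j : ℕ}
    (x : Fin j → Fin n) (s : EncodedSymbol L j) :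
    s.HoldsFin (restrict L n S) x ↔ s.Holds S (fun i => (x i : ℕ)) := by
  rcases s with ⟨m, R | ⟨f, i⟩, p⟩
  · rfl
  · exact restrict_fn_eq_some_iff S f _ _

theorem EncodedSymbol.measurableSet_holds {M : Type w} {j : ℕ} (x : Fin j → M)
    (s : EncodedSymbol L j) : MeasurableSet {S : L.Structure M | s.Holds S x} := by
  rcases s with ⟨m, R | ⟨f, i⟩, p⟩
  · exact measurableSet_relMap R _
  · exact measurableSet_funMap_eq f _ _

theorem EncodedSymbol.measurableSet_holdsFin {n j : ℕ} (x : Fin j → Fin n)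
    (s : EncodedSymbol L j) : MeasurableSet {a : FinRestriction L n | s.HoldsFin a x} := by
  rcases s with ⟨m, R | ⟨f, i⟩, p⟩
  · exact measurableSet_rel R _
  · exact measurableSet_fn_eq f _ _

variable (L) in
/-- The restricted structures whose functions take values among their arguments. -/
def valuesAmongArguments (n : ℕ) : Set (FinRestriction L n) :=
  {a | ∀ m (f : L.Functions m) (x : Fin m → Fin n), ∃ i, a.fn m f x = some (x i)}

section Encoding

variable [∀ m, Countable (L.Functions m)] [∀ m, Countable (L.Relations m)]

variable (L) in
/-- The relational language encoding structures of `L` whose functions take values among their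
arguments. -/
noncomputable def encodingLanguage : FirstOrder.Language.{0, 0} :=
  ⟨fun _ => Empty, fun j => Shrink.{0} (EncodedSymbol L j)⟩

instance encodingLanguage_isRelational : (encodingLanguage L).IsRelational :=
  fun _ => inferInstanceAs (IsEmpty Empty)

instance encodingLanguage_countable_relations (j : ℕ) :
    Countable ((encodingLanguage L).Relations j) :=
  (equivShrink (EncodedSymbol L j)).symm.injective.countable

/-- The non-redundant relational encoding of a structure. -/
noncomputable def encode {M : Type w} (S : L.Structure M) : (encodingLanguage L).Structure M where
  funMap := fun f => isEmptyElim f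
  RelMap := fun {j} r x =>
    Function.Injective x ∧ ((equivShrink (EncodedSymbol L j)).symm r).Holds S x

/-- The encoding of restricted structures. -/
noncomputable def encodeFin {n : ℕ} (a : FinRestriction L n) :
    FinRestriction (encodingLanguage L) n where
  fn := fun _ f => isEmptyElim f
  rel := fun j r x =>
    Function.Injective x ∧ ((equivShrink (EncodedSymbol L j)).symm r).HoldsFin a x

theorem measurable_encode {M : Type w} :
    Measurable (encode : L.Structure M → (encodingLanguage L).Structure M) :=
  measurable_of_measurableSet_relMap fun _ _ x =>
    (MeasurableSet.const _).inter (EncodedSymbol.measurableSet_holds x _)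

theorem measurable_encodeFin {n : ℕ} :
    Measurable (encodeFin : FinRestriction L n → FinRestriction (encodingLanguage L) n) := by
  refine measurable_generateFrom ?_
  rintro _ (⟨j, r, x, rfl⟩ | ⟨j, f, x, o, rfl⟩)
  · exact (MeasurableSet.const _).inter (EncodedSymbol.measurableSet_holdsFin x _)
  · exact isEmptyElim f

theorem logicAction_encode (σ : Equiv.Perm ℕ) (S : L.Structure ℕ) :
    logicAction (encodingLanguage L) σ (encode S) = encode (logicAction L σ S) := by
  refine FirstOrder.Language.Structure.ext ?_ ?_
  · funext j f
    exact isEmptyElim f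
  · funext j r x
    exact propext (and_congr (σ.symm.injective.of_comp_iff x)
      (EncodedSymbol.holds_logicAction σ S x _).symm)

theorem restrict_encode (n : ℕ) (S : L.Structure ℕ) :
    restrict (encodingLanguage L) n (encode S) = encodeFin (restrict L n S) := by
  refine FinRestriction.eq_iff.2 ⟨fun j r x => ?_, fun j f => isEmptyElim f⟩
  exact and_congr (Fin.val_injective.of_comp_iff x) (EncodedSymbol.holdsFin_restrict S x _).symm

theorem encode_mem_nonRedundant {M : Type w} (S : L.Structure M) :
    encode S ∈ NonRedundant (encodingLanguage L) M :=
  fun _ _ _ h => h.1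

theorem injOn_encodeFin (n : ℕ) : Set.InjOn encodeFin (valuesAmongArguments L n) := by
  intro a ha b _ hab
  have key : ∀ {j : ℕ} (s : EncodedSymbol L j) (x : Fin j → Fin n), Function.Injective x →
      (s.HoldsFin a x ↔ s.HoldsFin b x) := by
    intro j s x hx
    have h := ((FinRestriction.eq_iff.1 hab).1 j (equivShrink _ s) x)
    simpa [encodeFin, hx] using h
  have factor : ∀ {m : ℕ} (x : Fin m → Fin n), ∃ (j : ℕ) (_ : j ≤ m) (p : Fin m → Fin j)
      (y : Fin j → Fin n), Function.Injective y ∧ x = fun i => y (p i) := by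
    intro m x
    let t := Finset.univ.image x
    refine ⟨t.card, Finset.card_image_le.trans (by simp),
      fun i => t.equivFin ⟨x i, Finset.mem_image_of_mem x (Finset.mem_univ i)⟩,
      fun k => t.equivFin.symm k, Subtype.val_injective.comp t.equivFin.symm.injective, ?_⟩
    simp
  refine FinRestriction.eq_iff.2 ⟨fun m R x => ?_, fun m f x => ?_⟩
  · obtain ⟨j, hj, p, y, hy, rfl⟩ := factor x
    exact key ⟨⟨m, hj⟩, .inl R, p⟩ y hy
  · obtain ⟨j, hj, p, y, hy, rfl⟩ := factor x
    obtain ⟨i, hi⟩ := ha m f fun i => y (p i)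
    exact hi.trans ((key ⟨⟨m, hj⟩, .inr (f, i), p⟩ y hy).1 hi).symm

end Encoding

theorem measurableSet_valuesAmongArguments [∀ m, Countable (L.Functions m)] (n : ℕ) :
    MeasurableSet (valuesAmongArguments L n) := by
  simp only [valuesAmongArguments, Set.ofPred_forall, Set.ofPred_exists]
  exact MeasurableSet.iInter fun m => MeasurableSet.iInter fun f => MeasurableSet.iInter
    fun x => MeasurableSet.iUnion fun i => measurableSet_fn_eq f x _

theorem IsInvariantMeasure.map_restrict_compl_valuesAmongArguments
    [∀ m, Countable (L.Functions m)] {μ : Measure (L.Structure ℕ)}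
    (hμ : IsInvariantMeasure L μ) (n : ℕ) :
    Measure.map (restrict L n) μ (valuesAmongArguments L n)ᶜ = 0 := by
  rw [Measure.map_apply (measurable_restrict n) (measurableSet_valuesAmongArguments n).compl]
  refine measure_mono_null (t := ⋃ (m) (f : L.Functions m) (x : Fin m → Fin n),
    {S : L.Structure ℕ | @funMap L ℕ S m f (fun i => (x i : ℕ)) ∉ Set.range fun i => (x i : ℕ)})
    ?_ ?_
  · intro S hS
    simp only [valuesAmongArguments, Set.mem_preimage, Set.mem_compl_iff, Set.mem_ofPred_eq,
      restrict_fn_eq_some_iff, not_forall] at hS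
    obtain ⟨m, f, x, h⟩ := hS
    simp only [Set.mem_iUnion]
    exact ⟨m, f, x, fun ⟨i, hi⟩ => h ⟨i, hi.symm⟩⟩
  · exact measure_iUnion_null fun m => measure_iUnion_null fun f => measure_iUnion_null fun x =>
      hμ.measure_funMap_notMem_range f _

end PaperEntropy

/-- For every invariant measure `μ` for a countable language `L₀` there
are a countable relational language `L₁` and a non-redundant invariant measure `ν` for
`L₁` with the same entropy function; moreover if `L₀` is finite with maximum arity `k`
then `L₁` may be taken finite with maximum arity `k`. -/
theorem entFn_realized_by_nonredundant
    (L₀ : FirstOrder.Language)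
    (_ : ∀ m, Countable (L₀.Functions m)) (_ : ∀ m, Countable (L₀.Relations m))
    (μ : Measure (L₀.Structure ℕ)) (hμ : IsInvariantMeasure L₀ μ) :
    ∃ L₁ : FirstOrder.Language.{0, 0}, L₁.IsRelational ∧
      (∀ m, Countable (L₁.Relations m)) ∧
      ∃ ν : Measure (L₁.Structure ℕ),
        IsInvariantMeasure L₁ ν ∧ ν (NonRedundant L₁ ℕ) = 1 ∧
        (∀ n : ℕ, entFn L₁ ν n = entFn L₀ μ n) ∧
        ((∀ m, Finite (L₀.Functions m) ∧ Finite (L₀.Relations m)) →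
          ∀ k : ℕ, (∀ m, k < m → IsEmpty (L₀.Functions m) ∧ IsEmpty (L₀.Relations m)) →
            (∀ m, Finite (L₁.Relations m)) ∧ (∀ m, k < m → IsEmpty (L₁.Relations m))) := by
  have hprob := hμ.1
  have hprob' := Measure.isProbabilityMeasure_map (μ := μ)
    (measurable_encode (L := L₀) (M := ℕ)).aemeasurable
  refine ⟨encodingLanguage L₀, inferInstance, inferInstance, Measure.map encode μ,
    ⟨hprob', fun σ => ?_⟩, ?_, fun n => ?_, fun hfin k hk => ⟨fun j => ?_, fun j hj => ?_⟩⟩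
  · have hae : AEMeasurable (logicAction L₀ σ) μ :=
      aemeasurable_of_map_neZero (by rw [hμ.2]; infer_instance)
    rw [Measure.map_map (measurable_logicAction σ) measurable_encode]
    conv_rhs => rw [← hμ.2 σ]
    rw [AEMeasurable.map_map_of_aemeasurable measurable_encode.aemeasurable hae]
    exact congrArg (Measure.map · μ) (funext (logicAction_encode σ))
  · refine le_antisymm prob_le_one ?_
    refine le_trans ?_ (Measure.le_map_apply measurable_encode.aemeasurable _)
    rw [Set.eq_univ_of_forall (s := encode ⁻¹' NonRedundant (encodingLanguage L₀) ℕ)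
      encode_mem_nonRedundant, measure_univ]
  · have := FinRestriction.measurableSingletonClass (L := encodingLanguage L₀) n
    unfold entFn
    rw [Measure.map_map (measurable_restrict n) measurable_encode,
      show restrict (encodingLanguage L₀) n ∘ encode = encodeFin ∘ restrict L₀ n from
        funext (restrict_encode n),
      ← Measure.map_map measurable_encodeFin (measurable_restrict n)]
    exact entropy_map_of_injOn measurable_encodeFin
      (hμ.map_restrict_compl_valuesAmongArguments n) (injOn_encodeFin n)
  · have := fun m => (hfin m).1
    have := fun m => (hfin m).2
    have hbound : ∀ s : EncodedSymbol L₀ j, (s.1 : ℕ) < k + 1 := by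
      rintro ⟨m, s, p⟩
      by_contra h
      obtain ⟨_, _⟩ := hk m (by simpa using h)
      exact isEmptyElim s
    have : Finite (EncodedSymbol L₀ j) := by
      let g : EncodedSymbol L₀ j → Σ m : Fin (k + 1),
          (L₀.Relations m ⊕ (L₀.Functions m × Fin m)) × (Fin m → Fin j) :=
        fun s => ⟨⟨s.1, hbound s⟩, s.2⟩
      refine Finite.of_injective g ?_
      rintro ⟨⟨m, hm⟩, s⟩ ⟨⟨m', hm'⟩, s'⟩ h
      obtain ⟨h₁, h₂⟩ := Sigma.mk.inj h
      obtain rfl : m = m' := congrArg Fin.val h₁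
      obtain rfl := eq_of_heq h₂
      rfl
    exact Finite.of_injective _ (equivShrink (EncodedSymbol L₀ j)).symm.injective
  · refine ⟨fun r => ?_⟩
    obtain ⟨⟨m, hm⟩, s, p⟩ := (equivShrink (EncodedSymbol L₀ j)).symm r
    obtain ⟨_, _⟩ := hk m (hj.trans_le hm)
    exact isEmptyElim s
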